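/- Let P be an ω-poset. If P is regular then the spectrum SP is Hausdorff. Conversely, if P is also prime and SP is Hausdorff, then P is regular. -/

import Mathlib

/-- `A` refines `B`: every element of `A` lies below some element of `B`. -/
def Refines {α : Type*} [PartialOrder α] (A B : Set α) : Prop :=
  ∀ a ∈ A, ∃ b ∈ B, a ≤ b

/-- A band: a finite subset such that every element of the poset is comparable with some member. -/
def IsBand {α : Type*} [PartialOrder α] (B : Set α) : Prop :=
  B.Finite ∧ ∀ p : α, ∃ b ∈ B, p ≤ b ∨ b ≤ p

/-- A cap: a subset refined by some band. -/
def IsCap {α : Type*} [PartialOrder α] (C : Set α) : Prop :=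
  ∃ B : Set α, IsBand B ∧ Refines B C

/-- A minimal cap: a cap no proper subset of which is a cap. -/
def IsMinimalCap {α : Type*} [PartialOrder α] (C : Set α) : Prop :=
  IsCap C ∧ ∀ D : Set α, D ⊂ C → ¬ IsCap D

/-- A selector: a subset meeting every cap. -/
def IsSelector {α : Type*} [PartialOrder α] (S : Set α) : Prop :=
  ∀ C : Set α, IsCap C → (S ∩ C).Nonempty

/-- A minimal selector: a selector minimal under inclusion among selectors. -/
def IsMinSelector {α : Type*} [PartialOrder α] (S : Set α) : Prop :=
  IsSelector S ∧ ∀ T : Set α, T ⊆ S → IsSelector T → T = S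

/-- An ω-poset: every principal filter is finite, and for each `n` only finitely many
principal filters have exactly `n` elements. -/
def IsOmegaPoset (α : Type*) [PartialOrder α] : Prop :=
  (∀ p : α, (Set.Ici p).Finite) ∧ ∀ n : ℕ, {p : α | (Set.Ici p).ncard = n}.Finite

/-- The rank of `p`: the length of the longest strictly increasing chain starting at `p`,
i.e. `r(p) = sup_{q > p} (r(q) + 1)`. -/
noncomputable def chainRank {α : Type*} [PartialOrder α] (p : α) : ℕ :=
  sSup {n : ℕ | ∃ c : ℕ → α, c 0 = p ∧ ∀ i < n, c i < c (i + 1)}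

/-- The `n`-th level: the minimal elements of the `n`-th cone `{p | chainRank p ≤ n}`. -/
def levelSet (α : Type*) [PartialOrder α] (n : ℕ) : Set α :=
  {p : α | chainRank p ≤ n ∧ ∀ q : α, q < p → ¬ chainRank q ≤ n}

/-- Predetermined: every non-minimal `p` has some `q < p` all of whose strict upper bounds
lie above `p`. -/
def Predetermined (α : Type*) [PartialOrder α] : Prop :=
  ∀ p : α, ¬ IsMin p → ∃ q : α, q < p ∧ ∀ r : α, q < r → p ≤ r

/-- Branching. -/
def Branching (α : Type*) [PartialOrder α] : Prop :=
  ∀ p q : α, p < q → ∃ r : α, r < q ∧ ¬ r ≤ p ∧ ¬ p ≤ r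

/-- The cap-order on elements: `p ≾ q` iff adding `q` to any family keeping `p` a cap keeps a cap. -/
def CapBelow {α : Type*} [PartialOrder α] (p q : α) : Prop :=
  ∀ F : Set α, IsCap (F ∪ {p}) → IsCap (F ∪ {q})

/-- Cap-determined: the cap-order on elements agrees with the order. -/
def CapDetermined (α : Type*) [PartialOrder α] : Prop :=
  ∀ p q : α, CapBelow p q → p ≤ q

/-- Graded: immediate predecessors have rank exactly one more. -/
def GradedPoset (α : Type*) [PartialOrder α] : Prop :=
  ∀ p q : α, p ⋖ q → chainRank p = chainRank q + 1

/-- `Wedge p q`: `p` and `q` have a common lower bound. -/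
def Wedge {α : Type*} [PartialOrder α] (p q : α) : Prop :=
  ∃ r : α, r ≤ p ∧ r ≤ q

/-- Star-below: `p ◁ q` iff there is a cap `C` with every element of the star `Cp` below `q`. -/
def StarBelow {α : Type*} [PartialOrder α] (p q : α) : Prop :=
  ∃ C : Set α, IsCap C ∧ ∀ c ∈ C, Wedge c p → c ≤ q

/-- Regular: every cap is ◁-refined by some cap. -/
def RegularPoset (α : Type*) [PartialOrder α] : Prop :=
  ∀ C : Set α, IsCap C → ∃ D : Set α, IsCap D ∧ ∀ d ∈ D, ∃ c ∈ C, StarBelow d c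

/-- Prime: for every `p` there is `F` with `F ∪ {p}` a cap but `F` not a cap. -/
def PrimePoset (α : Type*) [PartialOrder α] : Prop :=
  ∀ p : α, ∃ F : Set α, IsCap (F ∪ {p}) ∧ ¬ IsCap F

/-- Cluster: connected with respect to the common-lower-bound relation. -/
def IsCluster {α : Type*} [PartialOrder α] (C : Set α) : Prop :=
  ∀ A B : Set α, A.Nonempty → B.Nonempty → A ∪ B = C → ∃ a ∈ A, ∃ b ∈ B, Wedge a b

/-- `D^{≤_B ≥}`: the elements sharing an upper bound in `B` with some element of `D`. -/
def SharedUpper {α : Type*} [PartialOrder α] (D B : Set α) : Set α :=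
  {p : α | ∃ d ∈ D, ∃ b ∈ B, p ≤ b ∧ d ≤ b}

/-- Weakly tangled refinement. -/
def WeaklyTangledRefinement {α : Type*} [PartialOrder α] (A B : Set α) : Prop :=
  Refines A B ∧ ∀ C D : Set α, C ⊆ A → D ⊆ A → IsCluster C → IsCluster D →
    (C ∩ D).Nonempty → C ⊆ SharedUpper D B ∨ D ⊆ SharedUpper C B

/-- Weakly tangled poset: every cap has a weakly tangled refinement which is a cap. -/
def WeaklyTangled (α : Type*) [PartialOrder α] : Prop :=
  ∀ C : Set α, IsCap C → ∃ A : Set α, IsCap A ∧ WeaklyTangledRefinement A C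

/-- Injectivity of `≤` from level `n` to level `m`: every `p` in level `m` has a witness
`q` in level `n` below `p` and below no other element of level `m`. -/
def LevelInjOn (α : Type*) [PartialOrder α] (m n : ℕ) : Prop :=
  ∀ p ∈ levelSet α m, ∃ q ∈ levelSet α n,
    q ≤ p ∧ ∀ p' ∈ levelSet α m, q ≤ p' → p' = p

/-- The spectrum: the set of minimal selectors. -/
def Spectrum (α : Type*) [PartialOrder α] : Type _ :=
  {S : Set α // IsMinSelector S}

/-- The topology on the spectrum generated by the sets `p^∈ = {S | p ∈ S}`. -/
instance {α : Type*} [PartialOrder α] : TopologicalSpace (Spectrum α) :=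
  TopologicalSpace.generateFrom
    {U : Set (Spectrum α) | ∃ p : α, U = {S : Spectrum α | p ∈ S.1}}

/-- A basis of nonempty (open) sets. -/
def IsNeBasis {X : Type*} [TopologicalSpace X] (P : Set (Set X)) : Prop :=
  TopologicalSpace.IsTopologicalBasis P ∧ ∀ p ∈ P, p.Nonempty

/-- Cap-basis: a basis of nonempty open sets whose caps (under inclusion) are exactly
the covers of the space. -/
def IsCapBasis {X : Type*} [TopologicalSpace X] (P : Set (Set X)) : Prop :=
  IsNeBasis P ∧ ∀ C : Set ↥P, (IsCap C ↔ (⋃ c ∈ C, (c : Set X)) = Set.univ)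

/-- Band-basis: a basis of nonempty open sets whose bands (under inclusion) are exactly
the finite covers of the space. -/
def IsBandBasis {X : Type*} [TopologicalSpace X] (P : Set (Set X)) : Prop :=
  IsNeBasis P ∧ ∀ B : Set ↥P, (IsBand B ↔ B.Finite ∧ (⋃ b ∈ B, (b : Set X)) = Set.univ)

section Caps

variable {α : Type*} [PartialOrder α]

theorem IsCap.of_refines {C D : Set α} (hC : IsCap C) (h : Refines C D) : IsCap D := by
  obtain ⟨B, hB, hBC⟩ := hC
  refine ⟨B, hB, fun b hb => ?_⟩
  obtain ⟨c, hc, hbc⟩ := hBC b hb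
  obtain ⟨d, hd, hcd⟩ := h c hc
  exact ⟨d, hd, hbc.trans hcd⟩

theorem IsCap.mono {C D : Set α} (hC : IsCap C) (h : C ⊆ D) : IsCap D :=
  hC.of_refines fun c hc => ⟨c, h hc, le_rfl⟩

theorem IsCap.exists_finite_subset {C : Set α} (hC : IsCap C) :
    ∃ D ⊆ C, D.Finite ∧ IsCap D := by
  obtain ⟨B, hB, hBC⟩ := hC
  choose! f hf hle using hBC
  refine ⟨f '' B, Set.image_subset_iff.2 hf, hB.1.image f, B, hB, fun b hb => ?_⟩
  exact ⟨f b, Set.mem_image_of_mem f hb, hle b hb⟩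

end Caps

section Cones

variable {α : Type*} [PartialOrder α]

/-- The elements above which every strictly increasing chain (counting the element itself)
has at most `n` members. -/
def cone (α : Type*) [PartialOrder α] : ℕ → Set α
  | 0 => ∅
  | n + 1 => {p | ∀ q, p < q → q ∈ cone α n}

theorem cone_subset_succ (n : ℕ) : cone α n ⊆ cone α (n + 1) := by
  induction n with
  | zero => exact Set.empty_subset _
  | succ n ih => exact fun p hp q hq => ih (hp q hq)

theorem cone_mono : Monotone (cone α) :=
  monotone_nat_of_le_succ cone_subset_succ

theorem IsOmegaPoset.finite_cone (h : IsOmegaPoset α) (n : ℕ) : (cone α n).Finite := by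
  induction n with
  | zero => exact Set.finite_empty
  | succ n ih =>
    have hfin : (⋃ m ∈ Set.Iic ((cone α n).ncard + 1),
        {p : α | (Set.Ici p).ncard = m}).Finite :=
      (Set.finite_Iic _).biUnion fun m _ => h.2 m
    refine hfin.subset fun p hp => ?_
    simp only [Set.mem_iUnion, Set.mem_ofPred_eq, Set.mem_Iic, exists_prop, exists_eq_right']
    calc (Set.Ici p).ncard ≤ (insert p (cone α n)).ncard := by
          refine Set.ncard_le_ncard (fun q hq => ?_) (ih.insert p)
          rcases eq_or_lt_of_le (Set.mem_Ici.1 hq) with rfl | hlt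
          · exact Set.mem_insert _ _
          · exact Set.mem_insert_of_mem _ (hp q hlt)
      _ ≤ (cone α n).ncard + 1 := Set.ncard_insert_le _ _

theorem IsOmegaPoset.wellFounded_gt (h : IsOmegaPoset α) :
    WellFounded ((· > ·) : α → α → Prop) := by
  have hlt : ∀ p q : α, p > q → (Set.Ici p).ncard < (Set.Ici q).ncard := fun p q hpq =>
    Set.ncard_lt_ncard (Set.Ici_ssubset_Ici.2 hpq) (h.1 q)
  exact Subrelation.wf (fun {p q} hpq => hlt p q hpq)
    (InvImage.wf (fun p : α => (Set.Ici p).ncard) Nat.lt_wfRel.wf)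

theorem IsOmegaPoset.exists_mem_cone (h : IsOmegaPoset α) (p : α) : ∃ n, p ∈ cone α n := by
  induction p using h.wellFounded_gt.induction with
  | _ p ih =>
    choose! n hn using ih
    have hfin : (Set.Ioi p).Finite := (h.1 p).subset Set.Ioi_subset_Ici_self
    obtain ⟨m, hm⟩ := (hfin.image n).bddAbove
    exact ⟨m + 1, fun q hq => cone_mono (hm (Set.mem_image_of_mem n hq)) (hn q hq)⟩

theorem IsOmegaPoset.isBand_minimal_cone (h : IsOmegaPoset α) (n : ℕ) :
    IsBand {p | Minimal (· ∈ cone α (n + 1)) p} := by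
  refine ⟨(h.finite_cone (n + 1)).subset fun p hp => hp.prop, fun p => ?_⟩
  by_cases hp : p ∈ cone α (n + 1)
  · obtain ⟨q, hqp, hq⟩ := (h.finite_cone (n + 1)).exists_le_minimal hp
    exact ⟨q, hq, Or.inr hqp⟩
  · have hfin : {q | p ≤ q ∧ q ∉ cone α n}.Finite := (h.1 p).subset fun q hq => hq.1
    have hmem : p ∈ {q | p ≤ q ∧ q ∉ cone α n} :=
      ⟨le_rfl, fun hp' => hp (cone_subset_succ n hp')⟩
    obtain ⟨q, hpq, hq⟩ := hfin.exists_le_maximal hmem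
    refine ⟨q, ⟨fun r hr => ?_, fun r hr hrq => ?_⟩, Or.inl hpq⟩
    · by_contra hr'
      exact hr.not_ge (hq.2 ⟨hpq.trans hr.le, hr'⟩ hr.le)
    · rcases eq_or_lt_of_le hrq with rfl | hlt
      · exact le_rfl
      · exact absurd (hr q hlt) hq.prop.2

theorem IsOmegaPoset.exists_isBand_refines (h : IsOmegaPoset α) {F : Set α} (hF : F.Finite) :
    ∃ B : Set α, IsBand B ∧ ∀ C ⊆ F, IsBand C → Refines B C := by
  choose n hn using h.exists_mem_cone
  obtain ⟨m, hm⟩ := (hF.image n).bddAbove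
  refine ⟨_, h.isBand_minimal_cone m, fun C hCF hC p hp => ?_⟩
  obtain ⟨c, hc, hpc | hcp⟩ := hC.2 p
  · exact ⟨c, hc, hpc⟩
  · have hcm : c ∈ cone α (m + 1) :=
      cone_mono ((hm (Set.mem_image_of_mem n (hCF hc))).trans m.le_succ) (hn c)
    exact ⟨c, hc, hp.le_of_le hcm hcp⟩

theorem IsOmegaPoset.exists_isCap_refines (h : IsOmegaPoset α) {C D : Set α}
    (hC : IsCap C) (hD : IsCap D) : ∃ E : Set α, IsCap E ∧ Refines E C ∧ Refines E D := by
  obtain ⟨A, hA, hAC⟩ := hC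
  obtain ⟨B, hB, hBD⟩ := hD
  obtain ⟨E, hE, hEF⟩ := h.exists_isBand_refines (hA.1.union hB.1)
  refine ⟨E, ⟨E, hE, fun e he => ⟨e, he, le_rfl⟩⟩, fun e he => ?_, fun e he => ?_⟩
  · obtain ⟨a, ha, hea⟩ := hEF A Set.subset_union_left hA e he
    obtain ⟨c, hc, hac⟩ := hAC a ha
    exact ⟨c, hc, hea.trans hac⟩
  · obtain ⟨b, hb, heb⟩ := hEF B Set.subset_union_right hB e he
    obtain ⟨d, hd, hbd⟩ := hBD b hb
    exact ⟨d, hd, heb.trans hbd⟩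

end Cones

section Selectors

variable {α : Type*} [PartialOrder α]

theorem IsMinSelector.exists_isCap_inter_eq {S : Set α} (hS : IsMinSelector S) {p : α}
    (hp : p ∈ S) : ∃ C : Set α, IsCap C ∧ ∀ c ∈ C, c ∈ S → c = p := by
  by_contra! hcon
  have hsel : IsSelector (S \ {p}) := fun C hC => by
    obtain ⟨c, hc, hcS, hcp⟩ := hcon C hC
    exact ⟨c, ⟨hcS, hcp⟩, hc⟩
  have heq := hS.2 _ Set.sdiff_subset hsel
  rw [← heq] at hp
  exact hp.2 rfl

theorem IsMinSelector.isUpperSet {S : Set α} (hS : IsMinSelector S) : IsUpperSet S := by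
  intro p q hpq hp
  obtain ⟨C, hC, hCp⟩ := hS.exists_isCap_inter_eq hp
  have hD : IsCap (insert q (C \ {p})) := hC.of_refines fun c hc => by
    by_cases hcp : c = p
    · exact ⟨q, Set.mem_insert _ _, hcp.trans_le hpq⟩
    · exact ⟨c, Set.mem_insert_of_mem _ ⟨hc, hcp⟩, le_rfl⟩
  obtain ⟨d, hdS, rfl | hd⟩ := hS.1 _ hD
  · exact hdS
  · exact absurd (hCp d hd.1 hdS) hd.2

theorem IsMinSelector.exists_mem_le_le (h : IsOmegaPoset α) {S : Set α} (hS : IsMinSelector S)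
    {p q : α} (hp : p ∈ S) (hq : q ∈ S) : ∃ r ∈ S, r ≤ p ∧ r ≤ q := by
  obtain ⟨C, hC, hCp⟩ := hS.exists_isCap_inter_eq hp
  obtain ⟨D, hD, hDq⟩ := hS.exists_isCap_inter_eq hq
  obtain ⟨E, hE, hEC, hED⟩ := h.exists_isCap_refines hC hD
  obtain ⟨r, hrS, hrE⟩ := hS.1 E hE
  obtain ⟨c, hc, hrc⟩ := hEC r hrE
  obtain ⟨d, hd, hrd⟩ := hED r hrE
  refine ⟨r, hrS, ?_, ?_⟩
  · rwa [← hCp c hc (hS.isUpperSet hrc hrS)]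
  · rwa [← hDq d hd (hS.isUpperSet hrd hrS)]

theorem IsMinSelector.wedge (h : IsOmegaPoset α) {S : Set α} (hS : IsMinSelector S)
    {p q : α} (hp : p ∈ S) (hq : q ∈ S) : Wedge p q := by
  obtain ⟨r, -, hr⟩ := hS.exists_mem_le_le h hp hq
  exact ⟨r, hr⟩

theorem IsMinSelector.mem_of_starBelow (h : IsOmegaPoset α) {S : Set α} (hS : IsMinSelector S)
    {p q : α} (hp : p ∈ S) (hpq : StarBelow p q) : q ∈ S := by
  obtain ⟨C, hC, hCq⟩ := hpq
  obtain ⟨c, hcS, hc⟩ := hS.1 C hC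
  exact hS.isUpperSet (hCq c hc (hS.wedge h hcS hp)) hcS

theorem isSelector_sInter {c : Set (Set α)} (hc : ∀ S ∈ c, IsSelector S)
    (hchain : IsChain (· ⊆ ·) c) (hne : c.Nonempty) : IsSelector (⋂₀ c) := by
  intro C hC
  obtain ⟨D, hDC, hDfin, hD⟩ := hC.exists_finite_subset
  have hfin : ((fun S => S ∩ D) '' c).Finite :=
    hDfin.finite_subsets.subset (by rintro _ ⟨S, -, rfl⟩; exact Set.inter_subset_right)
  obtain ⟨_, ⟨S, hS, rfl⟩, hmin⟩ := hfin.exists_minimal (hne.image _)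
  obtain ⟨d, hdS, hd⟩ := hc S hS D hD
  refine ⟨d, fun T hT => ?_, hDC hd⟩
  rcases hchain.total hS hT with hST | hTS
  · exact hST hdS
  · exact (hmin (Set.mem_image_of_mem _ hT) (Set.inter_subset_inter_left D hTS) ⟨hdS, hd⟩).1

theorem IsSelector.exists_isMinSelector_subset {S : Set α} (hS : IsSelector S) :
    ∃ T ⊆ S, IsMinSelector T := by
  obtain ⟨T, hTS, hT⟩ := zorn_superset_nonempty {T : Set α | IsSelector T}
    (fun c hc hchain hne =>
      ⟨⋂₀ c, isSelector_sInter hc hchain hne, fun _ hs => Set.sInter_subset_of_mem hs⟩) S hS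
  exact ⟨T, hTS, hT.prop, fun U hUT hU => hUT.antisymm (hT.le_of_le hU hUT)⟩

theorem isCap_iff_forall_isMinSelector {C : Set α} :
    IsCap C ↔ ∀ S : Set α, IsMinSelector S → (S ∩ C).Nonempty := by
  refine ⟨fun hC S hS => hS.1 C hC, fun hC => ?_⟩
  by_contra hcap
  have hsel : IsSelector Cᶜ := fun D hD => by
    by_contra hdisj
    refine hcap (hD.mono fun d hd => ?_)
    by_contra hdC
    exact hdisj ⟨d, hdC, hd⟩
  obtain ⟨S, hSC, hS⟩ := hsel.exists_isMinSelector_subset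
  obtain ⟨c, hcS, hc⟩ := hC S hS
  exact hSC hcS hc

theorem PrimePoset.exists_isMinSelector_mem (hP : PrimePoset α) (p : α) :
    ∃ S : Set α, IsMinSelector S ∧ p ∈ S := by
  obtain ⟨F, hFp, hF⟩ := hP p
  by_contra! hcon
  refine hF (isCap_iff_forall_isMinSelector.2 fun S hS => ?_)
  obtain ⟨q, hqS, hq | rfl⟩ := hS.1 _ hFp
  · exact ⟨q, hqS, hq⟩
  · exact absurd hqS (hcon S hS)

end Selectors

namespace Spectrum

variable {α : Type*} [PartialOrder α]

theorem isOpen_setOf_mem (p : α) : IsOpen {S : Spectrum α | p ∈ S.1} :=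
  TopologicalSpace.isOpen_generateFrom_of_mem ⟨p, rfl⟩

theorem isTopologicalBasis (h : IsOmegaPoset α) : TopologicalSpace.IsTopologicalBasis
    {U : Set (Spectrum α) | ∃ p : α, U = {S : Spectrum α | p ∈ S.1}} where
  exists_subset_inter := by
    rintro _ ⟨p, rfl⟩ _ ⟨q, rfl⟩ S ⟨hp, hq⟩
    obtain ⟨r, hr, hrp, hrq⟩ := S.2.exists_mem_le_le h hp hq
    exact ⟨_, ⟨r, rfl⟩, hr, fun T hT => ⟨T.2.isUpperSet hrp hT, T.2.isUpperSet hrq hT⟩⟩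
  sUnion_eq := by
    refine Set.eq_univ_of_forall fun S => ?_
    obtain ⟨p, hp, -⟩ := S.2.1 _ ⟨_, h.isBand_minimal_cone 0, fun p hp => ⟨p, hp, le_rfl⟩⟩
    exact ⟨_, ⟨p, rfl⟩, hp⟩
  eq_generateFrom := rfl

instance compactSpace : CompactSpace (Spectrum α) := by
  refine compactSpace_generateFrom rfl fun P hP hcov => ?_
  have hcap : IsCap {p : α | {S : Spectrum α | p ∈ S.1} ∈ P} :=
    isCap_iff_forall_isMinSelector.2 fun S hS => by
      obtain ⟨U, hU, hSU⟩ := Set.mem_sUnion.1 (hcov ▸ Set.mem_univ (⟨S, hS⟩ : Spectrum α))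
      obtain ⟨p, rfl⟩ := hP hU
      exact ⟨p, hSU, hU⟩
  obtain ⟨D, hDP, hDfin, hD⟩ := hcap.exists_finite_subset
  refine ⟨(fun p => {S : Spectrum α | p ∈ S.1}) '' D, Set.image_subset_iff.2 hDP,
    hDfin.image _, Set.eq_univ_of_forall fun S => ?_⟩
  obtain ⟨d, hdS, hd⟩ := S.2.1 D hD
  exact ⟨_, Set.mem_image_of_mem _ hd, hdS⟩

theorem t2Space_of_regularPoset (h : IsOmegaPoset α) (hreg : RegularPoset α) :
    T2Space (Spectrum α) := by
  refine ⟨fun S T hne => ?_⟩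
  obtain ⟨p, hpS, hpT⟩ : ∃ p ∈ S.1, p ∉ T.1 := by
    by_contra! hsub
    exact hne (Subtype.ext (T.2.2 S.1 hsub S.2.1))
  obtain ⟨C, hC, hCp⟩ := S.2.exists_isCap_inter_eq hpS
  obtain ⟨D, hD, hDC⟩ := hreg C hC
  obtain ⟨d, hdS, hd⟩ := S.2.1 D hD
  obtain ⟨c, hc, hdc⟩ := hDC d hd
  obtain rfl : c = p := hCp c hc (S.2.mem_of_starBelow h hdS hdc)
  obtain ⟨E, hE, hEc⟩ := hdc
  obtain ⟨e, heT, he⟩ := T.2.1 E hE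
  refine ⟨_, _, isOpen_setOf_mem d, isOpen_setOf_mem e, hdS, heT, ?_⟩
  refine Set.disjoint_left.2 fun U hdU heU => hpT ?_
  exact T.2.isUpperSet (hEc e he (U.2.wedge h heU hdU)) heT

theorem starBelow_of_closure_subset (h : IsOmegaPoset α) (hP : PrimePoset α) {p q : α}
    (hpq : closure {S : Spectrum α | p ∈ S.1} ⊆ {S : Spectrum α | q ∈ S.1}) :
    StarBelow p q := by
  refine ⟨insert q {r | ¬ Wedge r p}, isCap_iff_forall_isMinSelector.2 fun S hS => ?_, ?_⟩
  · by_cases hq : q ∈ S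
    · exact ⟨q, hq, Set.mem_insert _ _⟩
    · have hcl : (⟨S, hS⟩ : Spectrum α) ∉ closure {S : Spectrum α | p ∈ S.1} :=
        fun hmem => hq (hpq hmem)
      have hbasis := mt (isTopologicalBasis h).mem_closure_iff.2 hcl
      push Not at hbasis
      obtain ⟨_, ⟨r, rfl⟩, hr, hdisj⟩ := hbasis
      refine ⟨r, hr, Set.mem_insert_of_mem _ ?_⟩
      rintro ⟨s, hsr, hsp⟩
      obtain ⟨T, hT, hsT⟩ := hP.exists_isMinSelector_mem s
      have hmem : (⟨T, hT⟩ : Spectrum α) ∈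
          {S : Spectrum α | r ∈ S.1} ∩ {S : Spectrum α | p ∈ S.1} :=
        ⟨hT.isUpperSet hsr hsT, hT.isUpperSet hsp hsT⟩
      exact Set.eq_empty_iff_forall_notMem.1 hdisj _ hmem
  · rintro r (rfl | hr) hrp
    · exact le_rfl
    · exact absurd hrp hr

theorem regularPoset_of_t2Space (h : IsOmegaPoset α) (hP : PrimePoset α)
    [T2Space (Spectrum α)] : RegularPoset α := by
  intro C hC
  refine ⟨{d | ∃ c ∈ C, StarBelow d c}, isCap_iff_forall_isMinSelector.2 fun S hS => ?_,
    fun d hd => hd⟩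
  obtain ⟨c, hcS, hc⟩ := hS.1 C hC
  obtain ⟨U, hU, hUclosed, hUc⟩ := exists_mem_nhds_isClosed_subset
    ((isOpen_setOf_mem c).mem_nhds (show (⟨S, hS⟩ : Spectrum α) ∈ _ from hcS))
  obtain ⟨_, ⟨d, rfl⟩, hdS, hdU⟩ := (isTopologicalBasis h).mem_nhds_iff.1 hU
  exact ⟨d, hdS, c, hc, starBelow_of_closure_subset h hP
    ((closure_minimal hdU hUclosed).trans hUc)⟩

end Spectrum

/-- For an ω-poset, regularity implies the spectrum is Hausdorff;
conversely, if the poset is prime and the spectrum is Hausdorff then it is regular. -/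
theorem regular_iff_spectrum_hausdorff {α : Type*} [PartialOrder α] (h : IsOmegaPoset α) :
    (RegularPoset α → T2Space (Spectrum α)) ∧
    (PrimePoset α → T2Space (Spectrum α) → RegularPoset α) := by
  exact ⟨Spectrum.t2Space_of_regularPoset h, fun hP _ => Spectrum.regularPoset_of_t2Space h hP⟩
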